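/- The one-sided limits of the map δ ↦ OPT(δ) satisfy lim_{δ→0⁺} OPT(δ) = OPT and lim_{δ→1⁻} OPT(δ) = 0. -/

import Mathlib

open scoped BigOperators

/-- An instance of a hidden-action principal-agent problem with action set `A`
and outcome set `O`. -/
structure PAInstance (A O : Type*) [Fintype A] [Fintype O] [Nonempty A] [Nonempty O] where
  /-- `F a ω` is the probability that action `a` results in outcome `ω`. -/
  F : A → O → ℝ
  /-- principal's reward vector -/
  r : O → ℝ
  /-- agent's cost vector -/
  c : A → ℝ
  F_nonneg : ∀ a ω, 0 ≤ F a ω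
  F_sum : ∀ a, ∑ ω, F a ω = 1
  r_mem : ∀ ω, r ω ∈ Set.Icc (0 : ℝ) 1
  c_mem : ∀ a, c a ∈ Set.Icc (0 : ℝ) 1
  /-- the opt-out action -/
  optOut : A
  optOut_cost : c optOut = 0
  optOut_reward : ∑ ω, F optOut ω * r ω = 0

namespace PAInstance

variable {A O : Type*} [Fintype A] [Fintype O] [Nonempty A] [Nonempty O]

/-- A contract is a vector of nonnegative payments, one per outcome. -/
def IsContract (p : O → ℝ) : Prop := ∀ ω, 0 ≤ p ω

/-- Agent's expected utility `u^A(p, a) = F_a · p - c_a`. -/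
def uA (I : PAInstance A O) (p : O → ℝ) (a : A) : ℝ := (∑ ω, I.F a ω * p ω) - I.c a

/-- Principal's expected utility `u^P(p, a) = F_a · (r - p)`. -/
def uP (I : PAInstance A O) (p : O → ℝ) (a : A) : ℝ := ∑ ω, I.F a ω * (I.r ω - p ω)

/-- The set of (exact) best responses `A(p)`. -/
def BR (I : PAInstance A O) (p : O → ℝ) : Set A := {a | ∀ a', I.uA p a' ≤ I.uA p a}

/-- The set of `δ`-best responses
`A^δ(p) = {a : u^A(p,a) > max_{a'} u^A(p,a') - δ}`. -/
def dBR (I : PAInstance A O) (δ : ℝ) (p : O → ℝ) : Set A :=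
  {a | ∀ a', I.uA p a' - δ < I.uA p a}

/-- `Ψ_δ(p) = min_{a ∈ A^δ(p)} u^P(p, a)`, the principal's robust utility in `p`. -/
noncomputable def Psi (I : PAInstance A O) (δ : ℝ) (p : O → ℝ) : ℝ :=
  sInf (I.uP p '' I.dBR δ p)

/-- `OPT(δ)`: the optimal δ-robust value. -/
noncomputable def OPTrob (I : PAInstance A O) (δ : ℝ) : ℝ :=
  sSup {x | ∃ p, IsContract p ∧ x = I.Psi δ p}

/-- `OPT`: value of an optimal (non-robust) contract, where the agent breaks
ties in favor of the principal. -/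
noncomputable def OPT (I : PAInstance A O) : ℝ :=
  sSup {x | ∃ p, IsContract p ∧ x = sSup (I.uP p '' I.BR p)}

/-- `SW = max_a (F_a · r - c_a)`, the maximum social welfare. -/
noncomputable def SW (I : PAInstance A O) : ℝ :=
  sSup (Set.range fun a => (∑ ω, I.F a ω * I.r ω) - I.c a)

end PAInstance

namespace PAInstance

variable {A O : Type*} [Fintype A] [Fintype O] [Nonempty A] [Nonempty O]

theorem sum_F_mul_le_one (I : PAInstance A O) (a : A) : ∑ ω, I.F a ω * I.r ω ≤ 1 := by
  rw [← I.F_sum a]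
  exact Finset.sum_le_sum fun ω _ => mul_le_of_le_one_right (I.F_nonneg a ω) (I.r_mem ω).2

theorem sum_F_mul_nonneg (I : PAInstance A O) {p : O → ℝ} (hp : IsContract p) (a : A) :
    0 ≤ ∑ ω, I.F a ω * p ω :=
  Finset.sum_nonneg fun ω _ => mul_nonneg (I.F_nonneg a ω) (hp ω)

theorem uP_eq_sub (I : PAInstance A O) (p : O → ℝ) (a : A) :
    I.uP p a = ∑ ω, I.F a ω * I.r ω - ∑ ω, I.F a ω * p ω := by
  simp only [uP, mul_sub, Finset.sum_sub_distrib]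

theorem uP_le_one (I : PAInstance A O) {p : O → ℝ} (hp : IsContract p) (a : A) :
    I.uP p a ≤ 1 := by
  rw [uP_eq_sub]
  linarith [I.sum_F_mul_le_one a, I.sum_F_mul_nonneg hp a]

theorem BR_nonempty (I : PAInstance A O) (p : O → ℝ) : (I.BR p).Nonempty :=
  Finite.exists_max (I.uA p)

theorem BR_subset_dBR (I : PAInstance A O) {δ : ℝ} (hδ : 0 < δ) (p : O → ℝ) :
    I.BR p ⊆ I.dBR δ p := fun _ ha a' => by linarith [ha a']

theorem dBR_nonempty (I : PAInstance A O) {δ : ℝ} (hδ : 0 < δ) (p : O → ℝ) :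
    (I.dBR δ p).Nonempty := (I.BR_nonempty p).mono (I.BR_subset_dBR hδ p)

theorem Psi_le_uP (I : PAInstance A O) {δ : ℝ} {p : O → ℝ} {a : A} (ha : a ∈ I.dBR δ p) :
    I.Psi δ p ≤ I.uP p a :=
  csInf_le (Set.toFinite _).bddBelow (Set.mem_image_of_mem _ ha)

theorem le_Psi (I : PAInstance A O) {δ : ℝ} (hδ : 0 < δ) {p : O → ℝ} {x : ℝ}
    (h : ∀ a ∈ I.dBR δ p, x ≤ I.uP p a) : x ≤ I.Psi δ p :=
  le_csInf ((I.dBR_nonempty hδ p).image _) (Set.forall_mem_image.2 h)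

theorem Psi_le_one (I : PAInstance A O) {δ : ℝ} (hδ : 0 < δ) {p : O → ℝ} (hp : IsContract p) :
    I.Psi δ p ≤ 1 := by
  obtain ⟨a, ha⟩ := I.dBR_nonempty hδ p
  exact (I.Psi_le_uP ha).trans (I.uP_le_one hp a)

theorem Psi_le_OPTrob (I : PAInstance A O) {δ : ℝ} (hδ : 0 < δ) {p : O → ℝ}
    (hp : IsContract p) : I.Psi δ p ≤ I.OPTrob δ := by
  refine le_csSup ⟨1, ?_⟩ ⟨p, hp, rfl⟩
  rintro _ ⟨q, hq, rfl⟩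
  exact I.Psi_le_one hδ hq

theorem OPTrob_le (I : PAInstance A O) {δ x : ℝ} (h : ∀ p, IsContract p → I.Psi δ p ≤ x) :
    I.OPTrob δ ≤ x := by
  refine csSup_le ⟨_, 0, fun _ => le_rfl, rfl⟩ ?_
  rintro _ ⟨p, hp, rfl⟩
  exact h p hp

theorem uP_le_OPT (I : PAInstance A O) {p : O → ℝ} (hp : IsContract p) {a : A}
    (ha : a ∈ I.BR p) : I.uP p a ≤ I.OPT := by
  refine (le_csSup (Set.toFinite _).bddAbove (Set.mem_image_of_mem _ ha)).trans ?_
  refine le_csSup ⟨1, ?_⟩ ⟨p, hp, rfl⟩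
  rintro _ ⟨q, hq, rfl⟩
  exact csSup_le ((I.BR_nonempty q).image _) (Set.forall_mem_image.2 fun a _ => I.uP_le_one hq a)

theorem OPT_le (I : PAInstance A O) {x : ℝ}
    (h : ∀ p, IsContract p → ∀ a ∈ I.BR p, I.uP p a ≤ x) : I.OPT ≤ x := by
  refine csSup_le ⟨_, 0, fun _ => le_rfl, rfl⟩ ?_
  rintro _ ⟨p, hp, rfl⟩
  exact csSup_le ((I.BR_nonempty p).image _) (Set.forall_mem_image.2 (h p hp))

theorem OPTrob_le_OPT (I : PAInstance A O) {δ : ℝ} (hδ : 0 < δ) : I.OPTrob δ ≤ I.OPT := by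
  refine I.OPTrob_le fun p hp => ?_
  obtain ⟨a, ha⟩ := I.BR_nonempty p
  exact (I.Psi_le_uP (I.BR_subset_dBR hδ p ha)).trans (I.uP_le_OPT hp ha)

theorem OPTrob_nonneg (I : PAInstance A O) {δ : ℝ} (hδ : 0 < δ) : 0 ≤ I.OPTrob δ := by
  refine le_trans (I.le_Psi hδ fun a _ => ?_) (I.Psi_le_OPTrob (p := 0) hδ fun _ => le_rfl)
  simpa [uP] using I.sum_F_mul_nonneg (fun ω => (I.r_mem ω).1) a

theorem OPTrob_le_one_sub (I : PAInstance A O) {δ : ℝ} (h0 : 0 < δ) (h1 : δ < 1) :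
    I.OPTrob δ ≤ 1 - δ := by
  refine I.OPTrob_le fun p hp => ?_
  obtain ⟨a, ha⟩ := I.BR_nonempty p
  have hpay := I.sum_F_mul_nonneg hp I.optOut
  by_cases hopt : I.optOut ∈ I.dBR δ p
  · have h := I.Psi_le_uP hopt
    rw [uP_eq_sub, I.optOut_reward] at h
    linarith
  · have hgap : I.uA p I.optOut ≤ I.uA p a - δ := by
      simp only [dBR, Set.mem_ofPred_eq, not_forall, not_lt] at hopt
      obtain ⟨a', h'⟩ := hopt
      linarith [ha a']
    simp only [uA, I.optOut_cost] at hgap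
    have h := I.Psi_le_uP (I.BR_subset_dBR h0 p ha)
    rw [uP_eq_sub] at h
    linarith [I.sum_F_mul_le_one a, (I.c_mem a).1]

/-- Moving a contract a fraction `ε` of the way towards the reward vector makes the agent
internalize a fraction `ε` of the principal's utility. -/
theorem uA_add_mul_sub (I : PAInstance A O) (p : O → ℝ) (ε : ℝ) (a : A) :
    I.uA (fun ω => p ω + ε * (I.r ω - p ω)) a = I.uA p a + ε * I.uP p a := by
  simp only [uA, uP, Finset.mul_sum, mul_add, Finset.sum_add_distrib, mul_left_comm ε]
  ring

theorem uP_add_mul_sub (I : PAInstance A O) (p : O → ℝ) (ε : ℝ) (a : A) :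
    I.uP (fun ω => p ω + ε * (I.r ω - p ω)) a = (1 - ε) * I.uP p a := by
  simp only [uP, Finset.mul_sum]
  exact Finset.sum_congr rfl fun ω _ => by ring

theorem OPT_le_OPTrob_add (I : PAInstance A O) {δ : ℝ} (h0 : 0 < δ) (h1 : δ < 1) :
    I.OPT ≤ I.OPTrob δ + 2 * √δ := by
  refine I.OPT_le fun p hp b hb => ?_
  set ε := √δ
  have hε : 0 < ε := Real.sqrt_pos.2 h0
  have hε1 : ε < 1 := by simpa using Real.sqrt_lt_sqrt h0.le h1
  have hsq : ε * ε = δ := Real.mul_self_sqrt h0.le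
  have hq : IsContract fun ω => p ω + ε * (I.r ω - p ω) := fun ω => by
    nlinarith [mul_nonneg hε.le (I.r_mem ω).1, mul_nonneg (sub_nonneg.2 hε1.le) (hp ω)]
  suffices h : I.uP p b - 2 * ε ≤ I.Psi δ fun ω => p ω + ε * (I.r ω - p ω) by
    linarith [I.Psi_le_OPTrob h0 hq]
  refine I.le_Psi h0 fun a ha => ?_
  have hab := ha b
  rw [uA_add_mul_sub, uA_add_mul_sub] at hab
  have hgap : I.uP p b - ε < I.uP p a := by
    refine lt_of_mul_lt_mul_left ?_ hε.le
    linarith [hb a]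
  rw [uP_add_mul_sub]
  have hmul := mul_le_mul_of_nonneg_left hgap.le (sub_nonneg.2 hε1.le)
  have hle := mul_le_mul_of_nonneg_left (I.uP_le_one hp b) hε.le
  linarith

end PAInstance

/-- `lim_{δ→0⁺} OPT(δ) = OPT` and `lim_{δ→1⁻} OPT(δ) = 0`. -/
theorem opt_robust_limits {A O : Type*} [Fintype A] [Fintype O] [Nonempty A] [Nonempty O]
    (I : PAInstance A O) :
    Filter.Tendsto (fun δ => I.OPTrob δ) (nhdsWithin 0 (Set.Ioo (0 : ℝ) 1)) (nhds I.OPT) ∧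
    Filter.Tendsto (fun δ => I.OPTrob δ) (nhdsWithin 1 (Set.Ioo (0 : ℝ) 1)) (nhds 0) := by
  constructor
  · have hlow : Filter.Tendsto (fun δ : ℝ => I.OPT - 2 * √δ)
        (nhdsWithin 0 (Set.Ioo (0 : ℝ) 1)) (nhds I.OPT) := by
      have hcont : Continuous fun δ : ℝ => I.OPT - 2 * √δ := by fun_prop
      simpa using (hcont.tendsto 0).mono_left (nhdsWithin_le_nhds (s := Set.Ioo (0 : ℝ) 1))
    refine tendsto_of_tendsto_of_tendsto_of_le_of_le' hlow tendsto_const_nhds ?_ ?_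
    · filter_upwards [self_mem_nhdsWithin] with δ hδ
      linarith [I.OPT_le_OPTrob_add hδ.1 hδ.2]
    · filter_upwards [self_mem_nhdsWithin] with δ hδ using I.OPTrob_le_OPT hδ.1
  · have hup : Filter.Tendsto (fun δ : ℝ => 1 - δ)
        (nhdsWithin 1 (Set.Ioo (0 : ℝ) 1)) (nhds 0) := by
      have hcont : Continuous fun δ : ℝ => 1 - δ := by fun_prop
      simpa using (hcont.tendsto 1).mono_left (nhdsWithin_le_nhds (s := Set.Ioo (0 : ℝ) 1))
    refine tendsto_of_tendsto_of_tendsto_of_le_of_le' tendsto_const_nhds hup ?_ ?_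
    · filter_upwards [self_mem_nhdsWithin] with δ hδ using I.OPTrob_nonneg hδ.1
    · filter_upwards [self_mem_nhdsWithin] with δ hδ using I.OPTrob_le_one_sub hδ.1 hδ.2
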